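/- arXiv:1412.3287 — 2 statements merged into one kernel-verified Lean document; each statement's English description precedes it below -/
import Mathlib

section
/- Let A be a fanning frame and F(t) its fundamental endomorphism. (1) If X : ℝ → Matrix (Fin n) (Fin n) ℝ is smooth with X(t) invertible for every t, then the fundamental endomorphism of the fanning frame t ↦ A(t)X(t) equals F(t) for every t. (2) If T is an invertible (kn)×(kn) real matrix, then the fundamental endomorphism of the fanning frame t ↦ T·A(t) is T·F(t)·T⁻¹. -/
open Matrix

noncomputable def mderiv {M N : ℕ} (A : ℝ → Matrix (Fin M) (Fin N) ℝ) :
    ℝ → Matrix (Fin M) (Fin N) ℝ :=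
  fun t => Matrix.of fun i j => deriv (fun s => A s i j) t

noncomputable def dmat {M N : ℕ} (i : ℕ) (A : ℝ → Matrix (Fin M) (Fin N) ℝ) :
    ℝ → Matrix (Fin M) (Fin N) ℝ :=
  mderiv^[i] A

def MatSmooth {M N : ℕ} (A : ℝ → Matrix (Fin M) (Fin N) ℝ) : Prop :=
  ∀ i j, ContDiff ℝ (⊤ : ℕ∞) fun t => A t i j

def juxt (k n : ℕ) (B : Fin k → Matrix (Fin (k * n)) (Fin n) ℝ) :
    Matrix (Fin (k * n)) (Fin (k * n)) ℝ :=
  Matrix.of fun r c => B (finProdFinEquiv.symm c).1 r (finProdFinEquiv.symm c).2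

noncomputable def frameMat (k n : ℕ) (A : ℝ → Matrix (Fin (k * n)) (Fin n) ℝ) (t : ℝ) :
    Matrix (Fin (k * n)) (Fin (k * n)) ℝ :=
  juxt k n fun i => dmat (i : ℕ) A t

def IsFanning (k n : ℕ) (A : ℝ → Matrix (Fin (k * n)) (Fin n) ℝ) : Prop :=
  MatSmooth A ∧ ∀ t, IsUnit (frameMat k n A t)

def IsCoeffs (k n : ℕ) (A : ℝ → Matrix (Fin (k * n)) (Fin n) ℝ)
    (P : ℕ → ℝ → Matrix (Fin n) (Fin n) ℝ) : Prop :=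
  (∀ i ∈ Finset.Icc 1 k, MatSmooth (P i)) ∧
  ∀ t, dmat k A t + ∑ i ∈ Finset.Icc 1 k, (k.choose i : ℝ) • (dmat (k - i) A t * P i t) = 0

noncomputable def Nmat (k n : ℕ) : Matrix (Fin (k * n)) (Fin (k * n)) ℝ :=
  Matrix.of fun r c =>
    if ((finProdFinEquiv.symm c).1 : ℕ) = ((finProdFinEquiv.symm r).1 : ℕ) + 1 ∧
        (finProdFinEquiv.symm c).2 = (finProdFinEquiv.symm r).2 then
      (((finProdFinEquiv.symm r).1 : ℕ) + 1 : ℝ)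
    else 0

noncomputable def fundEnd (k n : ℕ) (A : ℝ → Matrix (Fin (k * n)) (Fin n) ℝ) (t : ℝ) :
    Matrix (Fin (k * n)) (Fin (k * n)) ℝ :=
  frameMat k n A t * Nmat k n * (frameMat k n A t)⁻¹

noncomputable def fundRefl (k n : ℕ) (A : ℝ → Matrix (Fin (k * n)) (Fin n) ℝ) (t : ℝ) :
    Matrix (Fin (k * n)) (Fin (k * n)) ℝ :=
  (k : ℝ)⁻¹ • ((2 : ℝ) • mderiv (fundEnd k n A) t - ((k : ℝ) - 2) • (1 : Matrix (Fin (k * n)) (Fin (k * n)) ℝ))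

noncomputable def fundProj (k n : ℕ) (A : ℝ → Matrix (Fin (k * n)) (Fin n) ℝ) (t : ℝ) :
    Matrix (Fin (k * n)) (Fin (k * n)) ℝ :=
  (2 : ℝ)⁻¹ • ((1 : Matrix (Fin (k * n)) (Fin (k * n)) ℝ) - fundRefl k n A t)

noncomputable def horDer (k n : ℕ) (A : ℝ → Matrix (Fin (k * n)) (Fin n) ℝ)
    (P : ℕ → ℝ → Matrix (Fin n) (Fin n) ℝ) (t : ℝ) : Matrix (Fin (k * n)) (Fin n) ℝ :=
  dmat (k - 1) A t + ∑ i ∈ Finset.Icc 1 (k - 1), ((k - 1).choose i : ℝ) • (dmat (k - 1 - i) A t * P i t)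

noncomputable def jacobiEnd (k n : ℕ) (A : ℝ → Matrix (Fin (k * n)) (Fin n) ℝ) (t : ℝ) :
    Matrix (Fin (k * n)) (Fin (k * n)) ℝ :=
  (((k : ℝ)) ^ 2)⁻¹ • (mderiv (mderiv (fundEnd k n A)) t * mderiv (mderiv (fundEnd k n A)) t)

theorem dmat_apply {M N : ℕ} (m : ℕ) (A : ℝ → Matrix (Fin M) (Fin N) ℝ) (t : ℝ)
    (i : Fin M) (j : Fin N) :
    dmat m A t i j = iteratedDeriv m (fun s => A s i j) t := by
  induction m generalizing t with
  | zero => simp [dmat]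
  | succ m ih =>
    have h : dmat (m + 1) A = mderiv (dmat m A) := Function.iterate_succ_apply' _ _ _
    rw [h, iteratedDeriv_succ, ← funext ih]
    rfl

theorem MatSmooth.mul {L M N : ℕ} {A : ℝ → Matrix (Fin L) (Fin M) ℝ}
    {B : ℝ → Matrix (Fin M) (Fin N) ℝ} (hA : MatSmooth A) (hB : MatSmooth B) :
    MatSmooth fun t => A t * B t := by
  intro i j
  simp only [Matrix.mul_apply]
  exact ContDiff.sum fun l _ => (hA i l).mul (hB l j)

theorem matSmooth_const {M N : ℕ} (T : Matrix (Fin M) (Fin N) ℝ) : MatSmooth fun _ => T :=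
  fun _ _ => contDiff_const

/-- The Leibniz rule for products of smooth matrix-valued curves. -/
theorem dmat_mul {L M N : ℕ} {A : ℝ → Matrix (Fin L) (Fin M) ℝ}
    {B : ℝ → Matrix (Fin M) (Fin N) ℝ} (hA : MatSmooth A) (hB : MatSmooth B) (m : ℕ) (t : ℝ) :
    dmat m (fun s => A s * B s) t =
      ∑ i ∈ Finset.range (m + 1), (m.choose i : ℝ) • (dmat i A t * dmat (m - i) B t) := by
  have hle : (m : WithTop ℕ∞) ≤ ((⊤ : ℕ∞) : WithTop ℕ∞) := by exact_mod_cast le_top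
  ext r c
  have hprod (l : Fin M) := iteratedDeriv_mul (((hA r l).of_le hle).contDiffAt (x := t))
    (((hB l c).of_le hle).contDiffAt (x := t))
  have hsum : iteratedDeriv m (fun s => ∑ l, A s r l * B s l c) t =
      ∑ l, iteratedDeriv m (fun s => A s r l * B s l c) t :=
    iteratedDeriv_fun_sum fun l _ => (((hA r l).mul (hB l c)).of_le hle).contDiffAt
  simp only [dmat_apply, Matrix.mul_apply, Matrix.sum_apply, Matrix.smul_apply, smul_eq_mul,
    hsum, Finset.mul_sum]
  rw [Finset.sum_comm]
  refine Finset.sum_congr rfl fun l _ => (hprod l).trans ?_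
  exact Finset.sum_congr rfl fun i _ => mul_assoc _ _ _

theorem dmat_const_mul {L M N : ℕ} (T : Matrix (Fin L) (Fin M) ℝ)
    {B : ℝ → Matrix (Fin M) (Fin N) ℝ} (hB : MatSmooth B) (m : ℕ) (t : ℝ) :
    dmat m (fun s => T * B s) t = T * dmat m B t := by
  have hle : (m : WithTop ℕ∞) ≤ ((⊤ : ℕ∞) : WithTop ℕ∞) := by exact_mod_cast le_top
  ext r c
  have hsum : iteratedDeriv m (fun s => ∑ l, T r l * B s l c) t =
      ∑ l, iteratedDeriv m (fun s => T r l * B s l c) t :=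
    iteratedDeriv_fun_sum fun l _ => ((contDiff_const.mul (hB l c)).of_le hle).contDiffAt
  simp only [dmat_apply, Matrix.mul_apply, hsum, iteratedDeriv_const_mul_field]

theorem frameMat_const_mul {k n : ℕ} (T : Matrix (Fin (k * n)) (Fin (k * n)) ℝ)
    {A : ℝ → Matrix (Fin (k * n)) (Fin n) ℝ} (hA : MatSmooth A) (t : ℝ) :
    frameMat k n (fun s => T * A s) t = T * frameMat k n A t := by
  ext r c
  simp [frameMat, juxt, dmat_const_mul T hA, Matrix.mul_apply]

/-- The block upper triangular matrix whose `(i, j)` block is `(j choose i) • X^{(j-i)}`. -/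
noncomputable def leibnizMat (k n : ℕ) (X : ℝ → Matrix (Fin n) (Fin n) ℝ) (t : ℝ) :
    Matrix (Fin (k * n)) (Fin (k * n)) ℝ :=
  Matrix.of fun r c =>
    (((finProdFinEquiv.symm c).1 : ℕ).choose (finProdFinEquiv.symm r).1 : ℝ) *
      dmat (((finProdFinEquiv.symm c).1 : ℕ) - (finProdFinEquiv.symm r).1) X t
        (finProdFinEquiv.symm r).2 (finProdFinEquiv.symm c).2

theorem frameMat_mul {k n : ℕ} {A : ℝ → Matrix (Fin (k * n)) (Fin n) ℝ}
    {X : ℝ → Matrix (Fin n) (Fin n) ℝ} (hA : MatSmooth A) (hX : MatSmooth X) (t : ℝ) :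
    frameMat k n (fun s => A s * X s) t = frameMat k n A t * leibnizMat k n X t := by
  ext r c
  obtain ⟨⟨j, b⟩, rfl⟩ := finProdFinEquiv.surjective c
  rw [Matrix.mul_apply, ← finProdFinEquiv.sum_comp, Fintype.sum_prod_type]
  simp only [frameMat, juxt, leibnizMat, Matrix.of_apply, Equiv.symm_apply_apply,
    dmat_mul hA hX, Matrix.sum_apply, Matrix.smul_apply, Matrix.mul_apply, smul_eq_mul,
    Finset.mul_sum]
  rw [Fin.sum_univ_eq_sum_range (fun i => ∑ l, dmat i A t r l *
    (((j : ℕ).choose i : ℝ) * dmat ((j : ℕ) - i) X t l b)) k]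
  refine Finset.sum_subset_zero_on_sdiff (Finset.range_mono j.2) (fun i hi => ?_)
    fun i _ => Finset.sum_congr rfl fun l _ => mul_left_comm _ _ _
  have hlt : (j : ℕ) < i := by
    have := (Finset.mem_sdiff.1 hi).2
    rw [Finset.mem_range] at this
    omega
  simp [Nat.choose_eq_zero_of_lt hlt]

theorem Nmat_mul_leibnizMat (k n : ℕ) (X : ℝ → Matrix (Fin n) (Fin n) ℝ) (t : ℝ) :
    Nmat k n * leibnizMat k n X t = leibnizMat k n X t * Nmat k n := by
  ext r c
  obtain ⟨⟨i, a⟩, rfl⟩ := finProdFinEquiv.surjective r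
  obtain ⟨⟨j, b⟩, rfl⟩ := finProdFinEquiv.surjective c
  simp only [Matrix.mul_apply]
  rw [← finProdFinEquiv.sum_comp, Fintype.sum_prod_type,
    ← finProdFinEquiv.sum_comp, Fintype.sum_prod_type]
  simp only [Nmat, leibnizMat, Matrix.of_apply, Equiv.symm_apply_apply, ite_and, ite_mul,
    mul_ite, zero_mul, mul_zero]
  have hleft : ∀ i' : Fin k, (∑ l : Fin n, if (i' : ℕ) = i + 1 then if l = a then
      ((i : ℕ) + 1 : ℝ) * (((j : ℕ).choose i' : ℝ) * dmat ((j : ℕ) - i') X t l b) else 0 else 0) =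
      if (i' : ℕ) = i + 1 then
        ((i : ℕ) + 1 : ℝ) * (((j : ℕ).choose i' : ℝ) * dmat ((j : ℕ) - i') X t a b) else 0 := by
    intro i'
    split_ifs <;> simp
  have hright : ∀ i' : Fin k, (∑ l : Fin n, if (j : ℕ) = i' + 1 then if b = l then
      ((i' : ℕ).choose i : ℝ) * dmat ((i' : ℕ) - i) X t a l * ((i' : ℕ) + 1 : ℝ) else 0 else 0) =
      if (j : ℕ) = i' + 1 then
        ((i' : ℕ).choose i : ℝ) * dmat ((i' : ℕ) - i) X t a b * ((i' : ℕ) + 1 : ℝ) else 0 := by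
    intro i'
    split_ifs <;> simp
  simp only [hleft, hright]
  have hN : (∑ i' : Fin k, if (i' : ℕ) = i + 1 then
        ((i : ℕ) + 1 : ℝ) * (((j : ℕ).choose i' : ℝ) * dmat ((j : ℕ) - i') X t a b) else 0) =
      ((i : ℕ) + 1 : ℝ) *
        (((j : ℕ).choose (i + 1) : ℝ) * dmat ((j : ℕ) - (i + 1)) X t a b) := by
    rw [Fin.sum_univ_eq_sum_range (fun m => if m = (i : ℕ) + 1 then ((i : ℕ) + 1 : ℝ) *
      (((j : ℕ).choose m : ℝ) * dmat ((j : ℕ) - m) X t a b) else 0) k, Finset.sum_ite_eq']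
    split_ifs with h
    · rfl
    · have hlt : (j : ℕ) < i + 1 := j.2.trans_le (by simpa using h)
      simp [Nat.choose_eq_zero_of_lt hlt]
  rw [hN]
  obtain ⟨j, hj⟩ := j
  cases j with
  | zero => simp
  | succ m =>
    rw [Finset.sum_eq_single (⟨m, by omega⟩ : Fin k)]
    · have hc : ((m : ℝ) + 1) * (m.choose i : ℝ) = ((m + 1).choose (i + 1) : ℝ) * (i + 1) := by
        exact_mod_cast Nat.add_one_mul_choose_eq m i
      simp only [if_true, Nat.add_sub_add_right]
      linear_combination -(dmat (m - i) X t a b) * hc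
    · intro i' _ hne
      exact if_neg fun h => hne (Fin.ext (by simpa using h.symm))
    · simp

theorem isUnit_leibnizMat (k : ℕ) {n : ℕ} {X : ℝ → Matrix (Fin n) (Fin n) ℝ} {t : ℝ}
    (hX : IsUnit (X t)) : IsUnit (leibnizMat k n X t) := by
  have htri : (leibnizMat k n X t).BlockTriangular fun r => (finProdFinEquiv.symm r).1 := by
    intro r c hlt
    have hlt' : ((finProdFinEquiv.symm c).1 : ℕ) < (finProdFinEquiv.symm r).1 := hlt
    rw [leibnizMat, Matrix.of_apply, Nat.choose_eq_zero_of_lt hlt', Nat.cast_zero, zero_mul]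
  rw [Matrix.isUnit_iff_isUnit_det] at hX ⊢
  rw [htri.det_fintype]
  refine IsUnit.prod_univ_iff.2 fun i => ?_
  let e : Fin n ≃ {r : Fin (k * n) // (finProdFinEquiv.symm r).1 = i} :=
    { toFun := fun a => ⟨finProdFinEquiv (i, a), by simp⟩
      invFun := fun r => (finProdFinEquiv.symm r.1).2
      left_inv := fun a => by simp
      right_inv := by
        rintro ⟨r, rfl⟩
        exact Subtype.ext (finProdFinEquiv.apply_symm_apply r) }
  have hblock : ((leibnizMat k n X t).toSquareBlock
      (fun r => (finProdFinEquiv.symm r).1) i).submatrix e e = X t := by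
    ext a b
    simp only [e, leibnizMat, Matrix.toSquareBlock_def, Matrix.submatrix_apply, Matrix.of_apply,
      Equiv.coe_fn_mk, Equiv.symm_apply_apply]
    simp [dmat]
  rwa [← Matrix.det_submatrix_equiv_self e, hblock]

/-- Equivariance of the fundamental endomorphism `F(t) = 𝐀(t) N 𝐀(t)⁻¹`:
it is unchanged under `A ↦ A·X` and conjugated under `A ↦ T·A`. -/
theorem stmt_5 (k n : ℕ) (hk : 2 ≤ k) (hn : 1 ≤ n)
    (A : ℝ → Matrix (Fin (k * n)) (Fin n) ℝ) (hA : IsFanning k n A) :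
    (∀ X : ℝ → Matrix (Fin n) (Fin n) ℝ, MatSmooth X → (∀ t, IsUnit (X t)) →
      IsFanning k n (fun t => A t * X t) ∧
      ∀ t, fundEnd k n (fun s => A s * X s) t = fundEnd k n A t) ∧
    (∀ T : Matrix (Fin (k * n)) (Fin (k * n)) ℝ, IsUnit T →
      IsFanning k n (fun t => T * A t) ∧
      ∀ t, fundEnd k n (fun s => T * A s) t = T * fundEnd k n A t * T⁻¹) := by
  refine ⟨fun X hX hXu => ?_, fun T hT => ?_⟩
  · have hframe := frameMat_mul hA.1 hX
    refine ⟨⟨hA.1.mul hX, fun t => ?_⟩, fun t => ?_⟩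
    · rw [hframe]
      exact (hA.2 t).mul (isUnit_leibnizMat k (hXu t))
    · have hdet := (Matrix.isUnit_iff_isUnit_det _).1 (isUnit_leibnizMat k (hXu t))
      rw [fundEnd, hframe, Matrix.mul_inv_rev, Matrix.mul_assoc (frameMat k n A t),
        ← Nmat_mul_leibnizMat, ← Matrix.mul_assoc (frameMat k n A t), ← Matrix.mul_assoc,
        Matrix.mul_nonsing_inv_cancel_right _ _ hdet, fundEnd]
  · have hframe := frameMat_const_mul T hA.1
    refine ⟨⟨(matSmooth_const T).mul hA.1, fun t => ?_⟩, fun t => ?_⟩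
    · rw [hframe]
      exact hT.mul (hA.2 t)
    · simp only [fundEnd, hframe, Matrix.mul_inv_rev, Matrix.mul_assoc]
end

section
/- Let A be a fanning frame with fundamental endomorphism F(t), and let D(t) := (1/k)(2F'(t) − (k−2)·I). Then for every t ∈ ℝ: D(t)² = I; D(t)·A^{(i)}(t) = −A^{(i)}(t) for all 0 ≤ i ≤ k−2; and the (−1)-eigenspace {v ∈ ℝ^{kn} : D(t)v = −v} equals the span of the columns of A(t), A^{(1)}(t), …, A^{(k−2)}(t). -/
open Matrix

theorem dmat_succ {M N : ℕ} (i : ℕ) (A : ℝ → Matrix (Fin M) (Fin N) ℝ) :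
    dmat (i + 1) A = mderiv (dmat i A) :=
  Function.iterate_succ_apply' _ _ _

theorem MatSmooth.mderiv {M N : ℕ} {A : ℝ → Matrix (Fin M) (Fin N) ℝ} (hA : MatSmooth A) :
    MatSmooth (mderiv A) := fun i j =>
  (contDiff_infty_iff_deriv.mp (hA i j)).2

theorem MatSmooth.dmat {M N : ℕ} {A : ℝ → Matrix (Fin M) (Fin N) ℝ} (hA : MatSmooth A) (i : ℕ) :
    MatSmooth (dmat i A) := by
  induction i with
  | zero => exact hA
  | succ i ih => rw [dmat_succ]; exact ih.mderiv

theorem MatSmooth.differentiable {M N : ℕ} {A : ℝ → Matrix (Fin M) (Fin N) ℝ} (hA : MatSmooth A)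
    (i : Fin M) (j : Fin N) : Differentiable ℝ fun t => A t i j :=
  (hA i j).differentiable (by simp)

/-- Leibniz rule for the entrywise derivative of a product of matrix-valued maps. -/
theorem mderiv_mul {M N K : ℕ} {A : ℝ → Matrix (Fin M) (Fin N) ℝ} {B : ℝ → Matrix (Fin N) (Fin K) ℝ}
    (hA : ∀ i j, Differentiable ℝ fun t => A t i j)
    (hB : ∀ i j, Differentiable ℝ fun t => B t i j) (t : ℝ) :
    mderiv (fun s => A s * B s) t = mderiv A t * B t + A t * mderiv B t := by
  ext i j
  simp only [mderiv, Matrix.of_apply, Matrix.mul_apply, Matrix.add_apply]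
  rw [← Finset.sum_add_distrib]
  exact (HasDerivAt.fun_sum fun x _ =>
    ((hA i x t).hasDerivAt.mul (hB x j t).hasDerivAt)).deriv

theorem mderiv_const_smul {M N : ℕ} (c : ℝ) {A : ℝ → Matrix (Fin M) (Fin N) ℝ}
    (hA : ∀ i j, Differentiable ℝ fun t => A t i j) (t : ℝ) :
    mderiv (fun s => c • A s) t = c • mderiv A t := by
  ext i j
  exact ((hA i j t).hasDerivAt.const_mul c).deriv

theorem differentiable_det {M : ℕ} {A : ℝ → Matrix (Fin M) (Fin M) ℝ}
    (hA : ∀ i j, Differentiable ℝ fun t => A t i j) : Differentiable ℝ fun t => (A t).det := by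
  simp only [Matrix.det_apply']
  fun_prop

theorem differentiable_inv_entry {M : ℕ} {A : ℝ → Matrix (Fin M) (Fin M) ℝ}
    (hA : ∀ i j, Differentiable ℝ fun t => A t i j) (hu : ∀ t, IsUnit (A t)) (i j : Fin M) :
    Differentiable ℝ fun t => (A t)⁻¹ i j := by
  have hadj : Differentiable ℝ fun t => (A t).adjugate i j := by
    simp only [Matrix.adjugate_apply]
    refine differentiable_det fun a b => ?_
    by_cases h : a = j
    · subst h; simp
    · simpa [Matrix.updateRow_ne h] using hA a b
  simp only [Matrix.inv_def, Matrix.smul_apply, smul_eq_mul, Ring.inverse_eq_inv']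
  exact ((differentiable_det hA).inv fun t =>
    ((Matrix.isUnit_iff_isUnit_det _).mp (hu t)).ne_zero).mul hadj

section Fanning

variable {k n : ℕ} {A : ℝ → Matrix (Fin (k * n)) (Fin n) ℝ}

theorem frameMat_apply (t : ℝ) (r : Fin (k * n)) (i : Fin k) (c : Fin n) :
    frameMat k n A t r (finProdFinEquiv (i, c)) = dmat (i : ℕ) A t r c := by
  simp only [frameMat, juxt, Matrix.of_apply, Equiv.symm_apply_apply]

theorem IsFanning.differentiable_fundEnd (hA : IsFanning k n A) (i j : Fin (k * n)) :
    Differentiable ℝ fun t => fundEnd k n A t i j := by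
  have hf : ∀ i j, Differentiable ℝ fun t => frameMat k n A t i j := fun i j =>
    (hA.1.dmat (finProdFinEquiv.symm j).1).differentiable i (finProdFinEquiv.symm j).2
  have hi := differentiable_inv_entry hf hA.2
  simp only [fundEnd, Matrix.mul_apply]
  exact Differentiable.fun_sum fun x _ =>
    (Differentiable.fun_sum fun y _ => (hf i y).mul_const _).mul (hi x j)

theorem IsFanning.fundEnd_mul_dmat (hA : IsFanning k n A) {i : ℕ} (hi : i < k) (t : ℝ) :
    fundEnd k n A t * dmat i A t = (i : ℝ) • dmat (i - 1) A t := by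
  have h : fundEnd k n A t * frameMat k n A t = frameMat k n A t * Nmat k n := by
    rw [fundEnd, Matrix.nonsing_inv_mul_cancel_right _ _
      ((Matrix.isUnit_iff_isUnit_det _).mp (hA.2 t))]
  ext r c
  have h1 := congrFun (congrFun h r) (finProdFinEquiv (⟨i, hi⟩, c))
  have h2 : (fundEnd k n A t * frameMat k n A t) r (finProdFinEquiv (⟨i, hi⟩, c)) =
      (fundEnd k n A t * dmat i A t) r c := by
    simp only [Matrix.mul_apply, frameMat_apply]
  rw [← h2, h1, Matrix.mul_apply, ← finProdFinEquiv.sum_comp, Fintype.sum_prod_type]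
  simp only [frameMat_apply, Nmat, Matrix.of_apply, Equiv.symm_apply_apply, Matrix.smul_apply,
    smul_eq_mul]
  cases i with
  | zero => simp
  | succ i =>
    rw [Finset.sum_eq_single ⟨i, by omega⟩, Finset.sum_eq_single c]
    · simp [mul_comm]
    · intro d _ hd
      simp [hd.symm]
    · simp
    · intro j _ hj
      refine Finset.sum_eq_zero fun d _ => ?_
      have : ¬ i = (j : ℕ) := fun h => hj (Fin.ext h.symm)
      simp [this]
    · simp

theorem IsFanning.mderiv_fundEnd_mul_dmat (hA : IsFanning k n A) {i : ℕ} (hi : i < k) (t : ℝ) :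
    mderiv (fundEnd k n A) t * dmat i A t =
      (i : ℝ) • dmat i A t - fundEnd k n A t * dmat (i + 1) A t := by
  rw [eq_sub_iff_add_eq, dmat_succ,
    ← mderiv_mul hA.differentiable_fundEnd (hA.1.dmat i).differentiable]
  simp only [hA.fundEnd_mul_dmat hi]
  rw [mderiv_const_smul _ (hA.1.dmat _).differentiable]
  cases i with
  | zero => simp
  | succ i => rw [Nat.add_sub_cancel, ← dmat_succ]

theorem IsFanning.fundRefl_mul_dmat (hA : IsFanning k n A) {i : ℕ} (hi : i + 2 ≤ k) (t : ℝ) :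
    fundRefl k n A t * dmat i A t = -(dmat i A t) := by
  have hk : (k : ℝ) ≠ 0 := Nat.cast_ne_zero.mpr (by omega)
  rw [fundRefl, Matrix.smul_mul, Matrix.sub_mul, Matrix.smul_mul, Matrix.smul_mul, Matrix.one_mul,
    hA.mderiv_fundEnd_mul_dmat (by omega), hA.fundEnd_mul_dmat (by omega), Nat.add_sub_cancel]
  ext r c
  simp
  field_simp
  ring

theorem IsFanning.fundRefl_mul_dmat_last (hA : IsFanning k n A) (hk : 2 ≤ k) (t : ℝ) :
    fundRefl k n A t * dmat (k - 1) A t =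
      dmat (k - 1) A t - (2 / k : ℝ) • (fundEnd k n A t * dmat k A t) := by
  have hk0 : (k : ℝ) ≠ 0 := Nat.cast_ne_zero.mpr (by omega)
  rw [fundRefl, Matrix.smul_mul, Matrix.sub_mul, Matrix.smul_mul, Matrix.smul_mul, Matrix.one_mul,
    hA.mderiv_fundEnd_mul_dmat (by omega), Nat.sub_add_cancel (by omega)]
  ext r c
  simp [Nat.cast_sub (show 1 ≤ k by omega)]
  field_simp
  ring

theorem IsFanning.iSup_range_dmat (hA : IsFanning k n A) (t : ℝ) :
    ⨆ i : Fin k, LinearMap.range (dmat (i : ℕ) A t).mulVecLin = ⊤ := by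
  refine Submodule.eq_top_iff'.mpr fun v => ?_
  obtain ⟨w, rfl⟩ := (Matrix.mulVec_surjective_iff_isUnit.mpr (hA.2 t)) v
  have : frameMat k n A t *ᵥ w =
      ∑ i : Fin k, dmat (i : ℕ) A t *ᵥ fun c => w (finProdFinEquiv (i, c)) := by
    ext r
    simp only [Matrix.mulVec, dotProduct, Finset.sum_apply]
    rw [← finProdFinEquiv.sum_comp, Fintype.sum_prod_type]
    simp only [frameMat_apply]
  rw [this]
  exact Submodule.sum_mem _ fun i _ => Submodule.mem_iSup_of_mem i ⟨_, rfl⟩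

theorem dmat_mulVec_mem {i : ℕ} (hi : i < k - 1) (t : ℝ) (w : Fin n → ℝ) :
    dmat i A t *ᵥ w ∈ ⨆ i : Fin (k - 1), LinearMap.range (dmat (i : ℕ) A t).mulVecLin :=
  Submodule.mem_iSup_of_mem ⟨i, hi⟩ ⟨w, rfl⟩

theorem IsFanning.induction_dmat (hA : IsFanning k n A) (t : ℝ) (p : Submodule ℝ (Fin (k * n) → ℝ))
    (h : ∀ i < k, ∀ w, dmat i A t *ᵥ w ∈ p) (v : Fin (k * n) → ℝ) : v ∈ p := by
  have : (⊤ : Submodule ℝ (Fin (k * n) → ℝ)) ≤ p := by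
    rw [← hA.iSup_range_dmat t, iSup_le_iff]
    rintro i _ ⟨w, rfl⟩
    exact h i i.2 w
  exact this trivial

theorem IsFanning.fundEnd_mulVec_mem (hA : IsFanning k n A) (t : ℝ) (v : Fin (k * n) → ℝ) :
    fundEnd k n A t *ᵥ v ∈ ⨆ i : Fin (k - 1), LinearMap.range (dmat (i : ℕ) A t).mulVecLin := by
  refine hA.induction_dmat t (Submodule.comap (fundEnd k n A t).mulVecLin
    (⨆ i : Fin (k - 1), LinearMap.range (dmat (i : ℕ) A t).mulVecLin)) (fun i hi w => ?_) v
  rw [Submodule.mem_comap, Matrix.mulVecLin_apply, Matrix.mulVec_mulVec, hA.fundEnd_mul_dmat hi,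
    Matrix.smul_mulVec]
  rcases Nat.eq_zero_or_pos i with rfl | h
  · simp
  · exact Submodule.smul_mem _ _ (dmat_mulVec_mem (by omega) t w)

theorem IsFanning.fundRefl_mulVec_of_mem (hA : IsFanning k n A) (t : ℝ) {v : Fin (k * n) → ℝ}
    (hv : v ∈ ⨆ i : Fin (k - 1), LinearMap.range (dmat (i : ℕ) A t).mulVecLin) :
    fundRefl k n A t *ᵥ v = -v := by
  have : ⨆ i : Fin (k - 1), LinearMap.range (dmat (i : ℕ) A t).mulVecLin ≤
      LinearMap.eqLocus (fundRefl k n A t).mulVecLin (-LinearMap.id) := by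
    rw [iSup_le_iff]
    rintro i _ ⟨w, rfl⟩
    simp [LinearMap.mem_eqLocus, hA.fundRefl_mul_dmat (show (i : ℕ) + 2 ≤ k by omega),
      Matrix.neg_mulVec]
  exact this hv

theorem IsFanning.sub_fundRefl_mulVec_mem (hA : IsFanning k n A) (hk : 2 ≤ k) (t : ℝ)
    (v : Fin (k * n) → ℝ) :
    v - fundRefl k n A t *ᵥ v ∈
      ⨆ i : Fin (k - 1), LinearMap.range (dmat (i : ℕ) A t).mulVecLin := by
  refine hA.induction_dmat t
    (Submodule.comap (LinearMap.id - (fundRefl k n A t).mulVecLin)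
      (⨆ i : Fin (k - 1), LinearMap.range (dmat (i : ℕ) A t).mulVecLin)) (fun i hi w => ?_) v
  rw [Submodule.mem_comap, LinearMap.sub_apply, LinearMap.id_apply, Matrix.mulVecLin_apply,
    Matrix.mulVec_mulVec]
  rcases (show i + 2 ≤ k ∨ i = k - 1 by omega) with h | rfl
  · rw [hA.fundRefl_mul_dmat h, Matrix.neg_mulVec]
    have := dmat_mulVec_mem (A := A) (show i < k - 1 by omega) t w
    exact Submodule.sub_mem _ this (Submodule.neg_mem _ this)
  · rw [hA.fundRefl_mul_dmat_last hk, Matrix.sub_mulVec, sub_sub_cancel, Matrix.smul_mulVec,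
      ← Matrix.mulVec_mulVec]
    exact Submodule.smul_mem _ _ (hA.fundEnd_mulVec_mem t _)

end Fanning

/-- The fundamental reflection `D(t) = (1/k)(2F'(t) - (k-2)I)` squares to
the identity, acts as `-1` on the columns of `A, A', …, A^{(k-2)}`, and its
`(-1)`-eigenspace is exactly the span of those columns (the vertical space). -/
theorem stmt_6 (k n : ℕ) (hk : 2 ≤ k) (hn : 1 ≤ n)
    (A : ℝ → Matrix (Fin (k * n)) (Fin n) ℝ) (hA : IsFanning k n A) (t : ℝ) :
    fundRefl k n A t * fundRefl k n A t = 1 ∧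
    (∀ i : ℕ, i + 2 ≤ k → fundRefl k n A t * dmat i A t = -(dmat i A t)) ∧
    (∀ v : Fin (k * n) → ℝ, (fundRefl k n A t).mulVec v = -v ↔
      v ∈ ⨆ i : Fin (k - 1), LinearMap.range (dmat (i : ℕ) A t).mulVecLin) := by
  refine ⟨?_, fun i hi => hA.fundRefl_mul_dmat hi t, fun v =>
    ⟨fun hv => ?_, hA.fundRefl_mulVec_of_mem t⟩⟩
  · refine Matrix.ext_of_mulVec_single fun i => ?_
    have h := hA.fundRefl_mulVec_of_mem t (hA.sub_fundRefl_mulVec_mem hk t (Pi.single i 1))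
    rw [Matrix.mulVec_sub, Matrix.mulVec_mulVec, neg_sub] at h
    rw [Matrix.one_mulVec]
    exact sub_right_injective h
  · have h := hA.sub_fundRefl_mulVec_mem hk t v
    rw [hv, sub_neg_eq_add, ← two_smul ℝ] at h
    exact (Submodule.smul_mem_iff _ two_ne_zero).mp h
end
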